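/- arXiv:2110.14556 — 2 statements merged into one kernel-verified Lean document; each statement's English description precedes it below -/
import Mathlib

section
/- Let p be an odd prime, r = (p−1)/2, ε = (−1)^r, K = CyclotomicField p ℚ, ζ ∈ K a primitive p-th root of unity, c an integer with p ∤ c, γ = Σ_{x ∈ ZMod p} ζ^{c·x²}, and g = Σ_{x ∈ ZMod p} ζ^{x²}. Let S be the (r+1)×(r+1) matrix over K with S_{j,0} = ε·γ/p for all 0 ≤ j ≤ r, S_{0,k} = 2·ε·γ/p for 1 ≤ k ≤ r, and S_{j,k} = (ε·γ/p)·(ζ^{2cjk} + ζ^{−2cjk}) for 1 ≤ j, k ≤ r, and let V be the Vandermonde matrix V_{j,k} = ζ^{c·j²·k}; V is invertible. Then every entry of S' = V⁻¹ · S · V lies in the ring ℤ[(1+g)/2]: for all j, k there exist integers a, b with S'_{j,k} = a + b·(1+g)/2. -/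
open Polynomial NumberField

section Interpolation

variable {R : Type*} [CommRing R]

/-- Powers of the nodes of a Vandermonde matrix lie in the span of its columns over the base ring. -/
theorem exists_pow_eq_sum_mul_pow [Nontrivial R] {n : ℕ} (x : Fin (n + 1) → R) (m : ℕ) :
    ∃ w : Fin (n + 1) → R, ∀ j, x j ^ m = ∑ i, w i * x j ^ (i : ℕ) := by
  let P : R[X] := ∏ j, (X - C (x j))
  have hP : P.Monic := monic_prod_of_monic _ _ fun j _ ↦ monic_X_sub_C (x j)
  have hdeg : P.natDegree = n + 1 := by simp [P, natDegree_prod_of_monic, monic_X_sub_C]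
  have hlt : (X ^ m %ₘ P).natDegree < n + 1 :=
    hdeg ▸ natDegree_modByMonic_lt _ hP fun h ↦ by simp [h] at hdeg
  refine ⟨fun i ↦ (X ^ m %ₘ P).coeff i, fun j ↦ ?_⟩
  have hroot : P.eval (x j) = 0 := by
    rw [eval_prod]
    exact Finset.prod_eq_zero (Finset.mem_univ j) (by simp)
  have h := congrArg (eval (x j)) (modByMonic_add_div (X ^ m) P)
  rw [eval_add, eval_mul, hroot, zero_mul, add_zero, eval_pow, eval_X] at h
  rw [← h, eval_eq_sum_range' hlt,
    ← Fin.sum_univ_eq_sum_range (fun i ↦ (X ^ m %ₘ P).coeff i * x j ^ i)]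

/-- The Lagrange polynomial at the first node, up to its denominator, has coefficients in the base ring. -/
theorem exists_ite_eq_sum_mul_pow [Nontrivial R] {n : ℕ} (x : Fin (n + 1) → R) :
    ∃ w : Fin (n + 1) → R, ∀ j,
      (if j = 0 then ∏ i : Fin n, (x 0 - x i.succ) else 0) = ∑ i, w i * x j ^ (i : ℕ) := by
  let P : R[X] := ∏ j : Fin n, (X - C (x j.succ))
  have hdeg : P.natDegree < n + 1 := by simp [P, natDegree_prod_of_monic, monic_X_sub_C]
  refine ⟨fun i ↦ P.coeff i, fun j ↦ ?_⟩
  rw [Fin.sum_univ_eq_sum_range (fun i ↦ P.coeff i * x j ^ i), ← eval_eq_sum_range' hdeg, eval_prod]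
  split_ifs with h
  · simp [h]
  · obtain ⟨i, rfl⟩ := Fin.exists_succ_eq.2 h
    exact (Finset.prod_eq_zero (Finset.mem_univ i) (by simp)).symm

end Interpolation

section ZModLemmas

variable {p r : ℕ}

theorem ZMod.sum_eq_zero_add_sum_pairs [NeZero p] (hpr : p = 2 * r + 1) {M : Type*}
    [AddCommMonoid M] (F : ZMod p → M) :
    ∑ x, F x = F 0 + ∑ k : Fin r, (F ((k.succ : ℕ) : ZMod p) + F (-((k.succ : ℕ) : ZMod p))) := by
  have h : ∑ x, F x = ∑ i ∈ Finset.range p, F (i : ZMod p) := by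
    refine Finset.sum_nbij' (fun x ↦ x.val) (fun i ↦ (i : ZMod p)) ?_ ?_ ?_ ?_ ?_
    · simp [ZMod.val_lt]
    · simp
    · simp
    · intro i hi
      exact ZMod.val_cast_of_lt (Finset.mem_range.1 hi)
    · simp
  rw [h, Finset.sum_add_distrib]
  simp only [Fin.val_succ]
  rw [Fin.sum_univ_eq_sum_range (fun i ↦ F ((i + 1 : ℕ) : ZMod p)),
    Fin.sum_univ_eq_sum_range (fun i ↦ F (-((i + 1 : ℕ) : ZMod p))),
    ← Finset.sum_range_reflect (fun i ↦ F (-((i + 1 : ℕ) : ZMod p)))]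
  have h2 : ∀ i ∈ Finset.range r, F (-((r - 1 - i + 1 : ℕ) : ZMod p)) = F ((r + i + 1 : ℕ)) := by
    intro i hi
    congr 1
    rw [neg_eq_iff_add_eq_zero, ← Nat.cast_add, ZMod.natCast_eq_zero_iff]
    exact ⟨1, by have := Finset.mem_range.1 hi; omega⟩
  rw [Finset.sum_congr rfl h2]
  conv_lhs => rw [congrArg Finset.range hpr, Finset.sum_range_succ', two_mul, Finset.sum_range_add, add_comm]
  simp

theorem ZMod.fin_eq_of_sq_eq [Fact p.Prime] (hpr : p = 2 * r + 1) {j k : Fin (r + 1)}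
    (h : ((j : ℕ) : ZMod p) ^ 2 = ((k : ℕ) : ZMod p) ^ 2) : j = k := by
  have hj := j.is_lt
  have hk := k.is_lt
  rcases sq_eq_sq_iff_eq_or_eq_neg.1 h with h | h
  · rw [ZMod.natCast_eq_natCast_iff', Nat.mod_eq_of_lt (by omega), Nat.mod_eq_of_lt (by omega)] at h
    exact Fin.ext h
  · rw [← add_eq_zero_iff_eq_neg, ← Nat.cast_add, ZMod.natCast_eq_zero_iff] at h
    have := Nat.eq_zero_of_dvd_of_lt h (by omega)
    exact Fin.ext (by omega)

theorem ZMod.exists_perm_sq_eq [Fact p.Prime] (hpr : p = 2 * r + 1) {s : ZMod p} (hs : s ≠ 0) :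
    ∃ π : Equiv.Perm (Fin (r + 1)), ∀ j,
      ((π j : ℕ) : ZMod p) ^ 2 = (s * ((j : ℕ) : ZMod p)) ^ 2 := by
  have h : ∀ x : ZMod p, ∃ k : Fin (r + 1), ((k : ℕ) : ZMod p) ^ 2 = x ^ 2 := by
    intro x
    refine ⟨⟨x.valMinAbs.natAbs, ?_⟩, ?_⟩
    · have := ZMod.natAbs_valMinAbs_le x
      omega
    · have h := congrArg (Int.cast : ℤ → ZMod p) (Int.natAbs_sq x.valMinAbs)
      push_cast [ZMod.coe_valMinAbs] at h
      simpa using h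
  choose f hf using fun j : Fin (r + 1) ↦ h (s * ((j : ℕ) : ZMod p))
  have hinj : Function.Injective f := fun j k hjk ↦ ZMod.fin_eq_of_sq_eq hpr <| by
    have := (hf j).symm.trans (hjk ▸ hf k)
    rw [mul_pow, mul_pow] at this
    exact mul_left_cancel₀ (pow_ne_zero 2 hs) this
  exact ⟨Equiv.ofBijective f (Finite.injective_iff_bijective.1 hinj), hf⟩

end ZModLemmas

section Gauss

variable {p : ℕ} [Fact p.Prime] {K : Type*} [Field K]

theorem AddChar.sum_sq_eq_gaussSum (hp2 : p ≠ 2) {ψ : AddChar (ZMod p) K} (hψ : ψ ≠ 1) :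
    ∑ x, ψ (x ^ 2) = gaussSum ((quadraticChar (ZMod p)).ringHomComp (Int.castRingHom K)) ψ := by
  have hF : ringChar (ZMod p) ≠ 2 := (ZMod.ringChar_zmod_n p).substr hp2
  have h : ∑ x, ψ (x ^ 2) = ∑ a : ZMod p, ((quadraticChar (ZMod p) a + 1 : ℤ) : K) * ψ a := by
    rw [← Finset.sum_fiberwise (s := Finset.univ) (g := fun x : ZMod p ↦ x ^ 2)]
    refine Finset.sum_congr rfl fun a _ ↦ ?_
    rw [← quadraticChar_card_sqrts hF a,
      Finset.sum_congr rfl (g := fun _ ↦ ψ a) (by intro x hx; rw [(Finset.mem_filter.1 hx).2])]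
    simp
  simp [h, gaussSum, add_mul, Finset.sum_add_distrib, AddChar.sum_eq_zero_of_ne_one hψ]

theorem AddChar.sum_mul_sq_pow_two [CharZero K] {r : ℕ} (hpr : p = 2 * r + 1) {ψ : AddChar (ZMod p) K}
    (hψ : ψ.IsPrimitive) {b : ZMod p} (hb : b ≠ 0) :
    (∑ x, ψ (b * x ^ 2)) ^ 2 = (-1) ^ r * p := by
  have hF : ringChar (ZMod p) ≠ 2 := (ZMod.ringChar_zmod_n p).substr (by omega)
  have h1 : ψ.mulShift b ≠ 1 := hψ hb
  have h := AddChar.sum_sq_eq_gaussSum (p := p) (by omega) h1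
  simp only [AddChar.mulShift_apply] at h
  rw [h, gaussSum_sq _ ((quadraticChar_isQuadratic _).comp _) (AddChar.IsPrimitive.of_ne_one h1)]
  · rw [ZMod.card, MulChar.ringHomComp_apply, quadraticChar_neg_one hF, ZMod.card,
      ZMod.χ₄_eq_neg_one_pow (by omega), show p / 2 = r by omega]
    simp
  · rw [Ne, MulChar.ringHomComp_eq_one_iff Int.cast_injective]
    exact quadraticChar_ne_one hF

/-- Completing the square in a quadratic Gauss sum. -/
theorem AddChar.sum_linear_add_quadratic (ψ : AddChar (ZMod p) K) (c j : ZMod p) {k : ZMod p}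
    (hk : k ≠ 0) :
    ∑ x, ψ (2 * c * j * x) * ψ (c * x ^ 2 * k) =
      ψ (-(c * j ^ 2 * k⁻¹)) * ∑ x, ψ (c * k * x ^ 2) := by
  rw [← Equiv.sum_comp (Equiv.subRight (j * k⁻¹)), Finset.mul_sum]
  refine Finset.sum_congr rfl fun x _ ↦ ?_
  rw [← AddChar.map_add_eq_mul, ← AddChar.map_add_eq_mul, Equiv.subRight_apply]
  congr 1
  field_simp
  ring

end Gauss

section Cyclotomic

variable {p : ℕ} [Fact p.Prime] {K : Type*} [Field K]

theorem AddChar.zmodChar_intCast {ζ : K} (hζ : ζ ^ p = 1) (m : ℤ) :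
    AddChar.zmodChar p hζ (m : ZMod p) = ζ ^ m := by
  have h0 : ζ ≠ 0 := by
    rintro rfl
    simp [NeZero.ne p] at hζ
  have h : ((m % (p : ℤ)).toNat : ℤ) = m % p :=
    Int.toNat_of_nonneg (Int.emod_nonneg _ (by exact_mod_cast NeZero.ne p))
  have h2 : ((m % (p : ℤ)).toNat : ZMod p) = (m : ZMod p) := by
    rw [← Int.cast_natCast, h, ZMod.intCast_mod]
  rw [← h2, AddChar.zmodChar_apply', ← zpow_natCast, h]
  conv_rhs => rw [← Int.emod_add_mul_ediv m p, zpow_add₀ h0, zpow_mul, zpow_natCast, hζ, one_zpow,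
    mul_one]

theorem IsPrimitiveRoot.prod_one_sub_pow_dvd_of_sq_eq {A : Type*} [CommRing A] [IsDomain A]
    [IsIntegrallyClosed A] {r : ℕ} (hpr : p = 2 * r + 1) {η : A} (hη : IsPrimitiveRoot η p)
    {a : Fin r → ZMod p} (ha : ∀ i, a i ≠ 0) {y : A} (hy : y ^ 2 = (-1) ^ r * p) :
    ∏ i, (1 - η ^ (a i).val) ∣ y := by
  have key : ∀ j : ℕ, j.Coprime p → Associated (1 - η ^ j) (1 - η) := by
    intro j hj
    have := (hη.associated_sub_one_pow_sub_one_of_coprime hj).symm.neg_left.neg_right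
    simpa using this
  have hD : Associated (∏ i, (1 - η ^ (a i).val)) (∏ _i : Fin r, (1 - η)) := by
    refine Associated.prod _ _ _ fun i _ ↦ key _ ?_
    exact ZMod.val_coe_unit_coprime (Units.mk0 _ (ha i))
  have hP : Associated (p : A) (∏ _k ∈ Finset.range (2 * r), (1 - η)) := by
    have h := IsPrimitiveRoot.prod_one_sub_pow_eq_order (n := 2 * r) (hpr ▸ hη)
    have hp : (p : A) = ((2 * r : ℕ) : A) + 1 := by rw [hpr]; push_cast; rfl
    rw [hp, ← h]
    refine Associated.prod _ _ _ fun k hk ↦ key _ ?_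
    refine Nat.Coprime.symm (((Fact.out : p.Prime).coprime_iff_not_dvd).2 fun hd ↦ ?_)
    have := Nat.le_of_dvd (by omega) hd
    have := Finset.mem_range.1 hk
    omega
  rw [← IsIntegrallyClosed.pow_dvd_pow_iff two_ne_zero, hy]
  refine Dvd.dvd.mul_left ?_ _
  refine ((hD.pow_pow (n := 2)).dvd_iff_dvd_left).2 (hP.dvd_iff_dvd_right.2 ?_)
  simp [← pow_mul, mul_comm]

/-- The only integral linear relations between the `p`-th roots of unity are the constant ones. -/
theorem IsPrimitiveRoot.coeff_eq_of_sum_mul_zmodChar_eq_zero [CharZero K] {ζ : K}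
    (hζ : IsPrimitiveRoot ζ p) {n : ZMod p → ℤ}
    (h : ∑ i, (n i : K) * AddChar.zmodChar p hζ.pow_eq_one i = 0) (i : ZMod p) : n i = n 0 := by
  have hp : p.Prime := Fact.out
  let f : ℤ[X] := ∑ i : ZMod p, C (n i) * X ^ i.val
  have hf : aeval ζ f = 0 := by
    simpa [f, AddChar.zmodChar_apply] using h
  have hcoeff : ∀ i : ZMod p, f.coeff i.val = n i := by
    intro i
    simp [f, coeff_X_pow, (ZMod.val_injective p).eq_iff]
  have hdeg : f.natDegree ≤ p - 1 := by
    refine natDegree_sum_le_of_forall_le _ _ fun i _ ↦ (natDegree_C_mul_X_pow_le _ _).trans ?_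
    have := i.val_lt
    omega
  have hdvd : cyclotomic p ℤ ∣ f := by
    rw [cyclotomic_eq_minpoly hζ hp.pos]
    exact minpoly.isIntegrallyClosed_dvd (hζ.isIntegral hp.pos) hf
  obtain ⟨q, hq⟩ := hdvd
  have hq0 : q.natDegree = 0 := by
    by_cases h0 : q = 0
    · simp [h0]
    · rw [hq, natDegree_mul (cyclotomic_ne_zero _ _) h0, natDegree_cyclotomic,
        Nat.totient_prime hp] at hdeg
      omega
  obtain ⟨a, rfl⟩ := natDegree_eq_zero.1 hq0
  have hall : ∀ i : ZMod p, n i = a := by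
    intro i
    rw [← hcoeff i, hq, coeff_mul_C, cyclotomic_prime]
    simp [coeff_X_pow, i.val_lt]
  rw [hall, hall]

variable [CharZero K] [IsCyclotomicExtension {p} ℚ K]

theorem IsPrimitiveRoot.exists_eq_sum_mul_zmodChar {ζ : K} (hζ : IsPrimitiveRoot ζ p) {y : K}
    (hy : IsIntegral ℤ y) :
    ∃ n : ZMod p → ℤ, y = ∑ i, (n i : K) * AddChar.zmodChar p hζ.pow_eq_one i := by
  have := IsCyclotomicExtension.Rat.isIntegralClosure_adjoin_singleton_of_prime hζ
  obtain ⟨z, rfl⟩ := (IsIntegralClosure.isIntegral_iff (A := Algebra.adjoin ℤ {ζ})).1 hy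
  obtain ⟨q, hq⟩ := (Algebra.adjoin_singleton_eq_range_aeval ℤ ζ).le z.2
  have hmem : (z : K) ∈ Submodule.span ℤ (Set.range (AddChar.zmodChar p hζ.pow_eq_one)) := by
    rw [← hq]
    simp only [AlgHom.toRingHom_eq_coe, RingHom.coe_coe, aeval_eq_sum_range]
    refine Submodule.sum_mem _ fun i _ ↦ Submodule.smul_mem _ _ (Submodule.subset_span ⟨i, ?_⟩)
    exact AddChar.zmodChar_apply' _ _
  obtain ⟨n, hn⟩ := (Submodule.mem_span_range_iff_exists_fun ℤ).1 hmem
  exact ⟨n, by simpa [zsmul_eq_mul] using hn.symm⟩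

theorem IsPrimitiveRoot.exists_algEquiv_zmodChar {ζ : K} (hζ : IsPrimitiveRoot ζ p) {s : ZMod p}
    (hs : s ≠ 0) :
    ∃ σ : K ≃ₐ[ℚ] K, ∀ a, σ (AddChar.zmodChar p hζ.pow_eq_one a) =
      AddChar.zmodChar p hζ.pow_eq_one (s * a) := by
  have := IsCyclotomicExtension.numberField {p} ℚ K
  refine ⟨(IsCyclotomicExtension.Rat.galEquivZMod p K).symm (Units.mk0 s hs), fun a ↦ ?_⟩
  rw [IsCyclotomicExtension.Rat.galEquivZMod_apply_of_pow_eq p K, MulEquiv.apply_symm_apply,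
    Units.val_mk0, ← AddChar.map_nsmul_eq_pow, nsmul_eq_mul, ZMod.natCast_val, ZMod.cast_id', id]
  rw [← AddChar.map_nsmul_eq_pow]
  simp

/-- An algebraic integer of the `p`-th cyclotomic field fixed by the automorphisms `ζ ↦ ζ ^ (s ^ 2)`
lies in `ℤ[(1 + g) / 2]`, where `g` is the quadratic Gauss sum. -/
theorem IsPrimitiveRoot.exists_eq_add_mul_of_isIntegral_of_fixed (hp2 : p ≠ 2) {ζ : K}
    (hζ : IsPrimitiveRoot ζ p) {y : K} (hy : IsIntegral ℤ y)
    (hfix : ∀ s : ZMod p, s ≠ 0 → ∀ σ : K ≃ₐ[ℚ] K,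
      (∀ a, σ (AddChar.zmodChar p hζ.pow_eq_one a) =
        AddChar.zmodChar p hζ.pow_eq_one (s ^ 2 * a)) → σ y = y) :
    ∃ a b : ℤ, y = a + b * ((1 + ∑ x, AddChar.zmodChar p hζ.pow_eq_one (x ^ 2)) / 2) := by
  have hF : ringChar (ZMod p) ≠ 2 := (ZMod.ringChar_zmod_n p).substr hp2
  obtain ⟨n, hn⟩ := hζ.exists_eq_sum_mul_zmodChar hy
  have hψ : AddChar.zmodChar p hζ.pow_eq_one ≠ 1 := by
    rw [AddChar.zmod_char_ne_one_iff]
    have := AddChar.zmodChar_apply' (n := p) hζ.pow_eq_one 1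
    rw [Nat.cast_one, pow_one] at this
    rw [this]
    exact hζ.ne_one (Fact.out : p.Prime).one_lt
  have hinv : ∀ s i : ZMod p, s ≠ 0 → n (s ^ 2 * i) = n i := by
    intro s i hs
    have hs2 := pow_ne_zero 2 hs
    obtain ⟨σ, hσ⟩ := hζ.exists_algEquiv_zmodChar hs2
    have h1 := hfix s hs σ hσ
    have h2 : σ y = ∑ i, (n ((s ^ 2)⁻¹ * i) : K) * AddChar.zmodChar p hζ.pow_eq_one i := by
      rw [← Equiv.sum_comp (Equiv.mulLeft₀ _ hs2), hn, map_sum]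
      simp [hσ, hs]
    have h3 : ∑ i, ((n i - n ((s ^ 2)⁻¹ * i) : ℤ) : K) *
        AddChar.zmodChar p hζ.pow_eq_one i = 0 := by
      simp only [Int.cast_sub, sub_mul, Finset.sum_sub_distrib]
      rw [← h2, ← hn, h1, sub_self]
    have h4 := hζ.coeff_eq_of_sum_mul_zmodChar_eq_zero h3 (s ^ 2 * i)
    rw [inv_mul_cancel_left₀ hs2, mul_zero, sub_self] at h4
    exact sub_eq_zero.1 h4
  obtain ⟨t, ht⟩ := quadraticChar_exists_neg_one' hF
  have ht0 : (t : ZMod p) ≠ 0 := t.ne_zero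
  have hval : ∀ i : ZMod p, (2 * n i : ℤ) = (n 1 + n t) + (n 1 - n t) * quadraticChar (ZMod p) i +
      if i = 0 then 2 * n 0 - n 1 - n t else 0 := by
    intro i
    by_cases hi : i = 0
    · subst hi
      simp
    rw [if_neg hi]
    rcases quadraticChar_dichotomy hi with h | h
    · obtain ⟨s, hs⟩ := (quadraticChar_one_iff_isSquare hi).1 h
      have hs0 : s ≠ 0 := by rintro rfl; simp [hs] at hi
      have := hinv s 1 hs0
      rw [mul_one, sq, ← hs] at this
      rw [h, this]
      ring
    · have hq : quadraticChar (ZMod p) (i * t) = 1 := by rw [map_mul, h, ht]; rfl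
      obtain ⟨s, hs⟩ := (quadraticChar_one_iff_isSquare (mul_ne_zero hi ht0)).1 hq
      have hs0 : s ≠ 0 := by rintro rfl; simp [hi] at hs
      have := hinv (s * (t : ZMod p)⁻¹) t (mul_ne_zero hs0 (inv_ne_zero ht0))
      have he : (s * (t : ZMod p)⁻¹) ^ 2 * t = i := by
        field_simp
        rw [sq, ← hs, mul_comm]
      rw [he] at this
      rw [h, this]
      ring
  refine ⟨n 0 - n 1, n 1 - n t, ?_⟩
  have h2 : 2 * y = 2 * n 0 - n 1 - n t +
      (n 1 - n t) * ∑ x, AddChar.zmodChar p hζ.pow_eq_one (x ^ 2) := by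
    rw [AddChar.sum_sq_eq_gaussSum hp2 hψ, gaussSum, hn, Finset.mul_sum, Finset.mul_sum]
    have : ∀ i, 2 * ((n i : K) * AddChar.zmodChar p hζ.pow_eq_one i) =
        (n 1 + n t) * AddChar.zmodChar p hζ.pow_eq_one i +
        (n 1 - n t) * ((quadraticChar (ZMod p) i : K) * AddChar.zmodChar p hζ.pow_eq_one i) +
        if i = 0 then (2 * n 0 - n 1 - n t : K) else 0 := by
      intro i
      have h := congrArg (Int.cast : ℤ → K) (hval i)
      push_cast at h
      rw [← mul_assoc, h]
      split_ifs with hi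
      · simp [hi, AddChar.map_zero_eq_one]
      · ring
    simp only [this, Finset.sum_add_distrib, ← Finset.mul_sum, AddChar.sum_eq_zero_of_ne_one hψ,
      MulChar.ringHomComp_apply]
    simp
    ring
  refine mul_left_cancel₀ (two_ne_zero : (2 : K) ≠ 0) ?_
  rw [h2]
  push_cast
  ring

end Cyclotomic

section Conjugation

variable {p : ℕ} [Fact p.Prime] {K : Type*} [Field K] {r : ℕ}

theorem AddChar.sum_fin_eq_sum_zmod (hpr : p = 2 * r + 1) (ψ : AddChar (ZMod p) K) (κ : K)
    (c k : ZMod p) {S : Matrix (Fin (r + 1)) (Fin (r + 1)) K} (hS0 : ∀ j, S j 0 = κ)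
    (hS : ∀ j (i : Fin r), S j i.succ = κ *
      (ψ (2 * c * (j : ℕ) * (i.succ : ℕ)) + ψ (-(2 * c * (j : ℕ) * (i.succ : ℕ)))))
    (j : Fin (r + 1)) :
    ∑ i, S j i * ψ (c * ((i : ℕ) : ZMod p) ^ 2 * k) =
      κ * ∑ x, ψ (2 * c * (j : ℕ) * x) * ψ (c * x ^ 2 * k) := by
  rw [ZMod.sum_eq_zero_add_sum_pairs hpr, Fin.sum_univ_succ, mul_add, Finset.mul_sum, hS0]
  congr 1
  · simp [AddChar.map_zero_eq_one]
  · refine Finset.sum_congr rfl fun i _ ↦ ?_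
    rw [hS, neg_sq, mul_neg]
    ring

theorem Matrix.map_inv_mul_mul_eq_of_submatrix {n : Type*} [Fintype n] [DecidableEq n]
    {S V : Matrix n n K} (σ : K →+* K) (π : Equiv.Perm n)
    (hS : S.map σ = S.submatrix π π) (hV : V.map σ = V.submatrix π id) (hu : IsUnit V) :
    (V⁻¹ * S * V).map σ = V⁻¹ * S * V := by
  have hdet : IsUnit V.det := (Matrix.isUnit_iff_isUnit_det V).1 hu
  have hinv : V⁻¹.map σ = V⁻¹.submatrix id π := by
    have h1 : V⁻¹.map σ * V.map σ = 1 := by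
      rw [← Matrix.map_mul, Matrix.nonsing_inv_mul _ hdet, Matrix.map_one _ σ.map_zero σ.map_one]
    have h2 : (V.submatrix π id)⁻¹ = V⁻¹.submatrix id π :=
      Matrix.inv_submatrix_equiv V π (Equiv.refl n)
    rw [← h2, ← hV, Matrix.inv_eq_left_inv h1]
  rw [Matrix.map_mul, Matrix.map_mul, hS, hV, hinv, Matrix.submatrix_mul_equiv,
    Matrix.submatrix_mul_equiv, Matrix.submatrix_id_id]

/-- The columns of `S * V` are combinations of those of `V` with algebraic integer coefficients. -/
theorem IsPrimitiveRoot.exists_mul_vandermonde_apply_eq_sum [NumberField K]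
    (hpr : p = 2 * r + 1) {ζ : K} (hζ : IsPrimitiveRoot ζ p) {c : ZMod p} (hc : c ≠ 0) {κ γ : K}
    (hγ : γ = ∑ x, AddChar.zmodChar p hζ.pow_eq_one (c * x ^ 2)) (hκ : κ * γ = 1)
    {S V : Matrix (Fin (r + 1)) (Fin (r + 1)) K} (hS0 : ∀ j, S j 0 = κ)
    (hS : ∀ j (i : Fin r), S j i.succ = κ *
      (AddChar.zmodChar p hζ.pow_eq_one (2 * c * (j : ℕ) * (i.succ : ℕ)) +
        AddChar.zmodChar p hζ.pow_eq_one (-(2 * c * (j : ℕ) * (i.succ : ℕ)))))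
    (hV : ∀ j k, V j k =
      AddChar.zmodChar p hζ.pow_eq_one (c * ((j : ℕ) : ZMod p) ^ 2 * (k : ℕ)))
    (k : Fin (r + 1)) :
    ∃ w : Fin (r + 1) → 𝓞 K, ∀ j, (S * V) j k = ∑ i, V j i * w i := by
  set ψ := AddChar.zmodChar p hζ.pow_eq_one with hψdef
  have hψ : ψ.IsPrimitive := AddChar.zmodChar_primitive_of_primitive_root p hζ
  have hcast : ∀ a : ZMod p, ((hζ.toInteger ^ a.val : 𝓞 K) : K) = ψ a := by
    intro a
    rw [hψdef, AddChar.zmodChar_apply]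
    exact map_pow (algebraMap (𝓞 K) K) _ _
  have hψpow : ∀ a m : ZMod p, ψ (a * m) = ψ a ^ m.val := by
    intro a m
    rw [← AddChar.map_nsmul_eq_pow, nsmul_eq_mul, ZMod.natCast_val, ZMod.cast_id', id, mul_comm]
  let x : Fin (r + 1) → 𝓞 K := fun j ↦ hζ.toInteger ^ (c * ((j : ℕ) : ZMod p) ^ 2).val
  have hx : ∀ j, (x j : K) = ψ (c * ((j : ℕ) : ZMod p) ^ 2) := fun j ↦ hcast _
  have hVx : ∀ j i, V j i = (x j : K) ^ (i : ℕ) := by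
    intro j i
    rw [hV, hx, mul_comm _ ((i : ℕ) : ZMod p), ← nsmul_eq_mul, AddChar.map_nsmul_eq_pow]
  have hne : ∀ i : Fin r, ((i.succ : ℕ) : ZMod p) ≠ 0 := by
    intro i h
    rw [ZMod.natCast_eq_zero_iff] at h
    have := Nat.le_of_dvd (by simp) h
    have := i.succ.is_lt
    omega
  have hγ2 : γ ^ 2 = (-1) ^ r * p := hγ ▸ AddChar.sum_mul_sq_pow_two hpr hψ hc
  have hSV : ∀ j, (S * V) j k =
      κ * ∑ y, ψ (2 * c * (j : ℕ) * y) * ψ (c * y ^ 2 * (k : ℕ)) := by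
    intro j
    rw [Matrix.mul_apply, ← AddChar.sum_fin_eq_sum_zmod hpr ψ κ c _ hS0 hS]
    simp [hV]
  rcases Fin.eq_zero_or_eq_succ k with rfl | ⟨k, rfl⟩
  · let γ' : 𝓞 K := ∑ y : ZMod p, hζ.toInteger ^ (c * y ^ 2).val
    have hγ' : (γ' : K) = γ := by
      simp only [γ', hγ, ← hcast, map_sum]
    have hγ'2 : γ' ^ 2 = (-1) ^ r * p := by
      apply RingOfIntegers.coe_injective
      simp [hγ', hγ2]
    obtain ⟨t, ht⟩ := hζ.toInteger_isPrimitiveRoot.prod_one_sub_pow_dvd_of_sq_eq hpr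
      (a := fun i : Fin r ↦ c * ((i.succ : ℕ) : ZMod p) ^ 2)
      (fun i ↦ mul_ne_zero hc (pow_ne_zero 2 (hne i))) hγ'2
    obtain ⟨w, hw⟩ := exists_ite_eq_sum_mul_pow x
    refine ⟨fun i ↦ (-1) ^ r * t * w i, fun j ↦ ?_⟩
    have h2 : (2 : ZMod p) ≠ 0 := by
      have : ((2 : ℕ) : ZMod p) ≠ 0 := by
        rw [Ne, ZMod.natCast_eq_zero_iff]
        intro h
        have := Nat.le_of_dvd (by omega) h
        have := (Fact.out : p.Prime).two_le
        omega
      exact_mod_cast this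
    have hsum : ∑ y, ψ (2 * c * (j : ℕ) * y) * ψ (c * y ^ 2 * ((0 : Fin (r + 1)) : ℕ)) =
        if j = 0 then (p : K) else 0 := by
      have h := AddChar.sum_mulShift (2 * c * ((j : ℕ) : ZMod p)) hψ
      have hj : 2 * c * ((j : ℕ) : ZMod p) = 0 ↔ j = 0 := by
        constructor
        · intro h
          rcases Fin.eq_zero_or_eq_succ j with rfl | ⟨j, rfl⟩
          · rfl
          · exact absurd h (mul_ne_zero (mul_ne_zero h2 hc) (hne j))
        · rintro rfl
          simp
      simp only [hj, ZMod.card] at h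
      rw [Nat.cast_ite, Nat.cast_zero] at h
      simp [← h, AddChar.map_zero_eq_one, mul_comm]
    have hκp : κ * p = (-1) ^ r * γ := by
      have : (-1 : K) ^ r * (-1) ^ r = 1 := by rw [← mul_pow]; simp
      linear_combination (-1 : K) ^ r * γ * hκ - κ * p * this - κ * (-1) ^ r * hγ2
    rw [hSV, hsum]
    calc κ * (if j = 0 then (p : K) else 0) =
        (-1) ^ r * t * ((if j = 0 then ∏ i : Fin r, (x 0 - x i.succ) else 0 : 𝓞 K) : K) := by
          split_ifs
          · have hx0 : x 0 = 1 := by simp [x]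
            rw [hκp, ← hγ', ht, hx0]
            simp only [x, map_mul]
            ring
          · simp
      _ = _ := by
          rw [hw j]
          simp only [map_sum, map_mul, map_pow, map_neg, map_one, hVx, Finset.mul_sum]
          exact Finset.sum_congr rfl fun i _ ↦ by ring
  · obtain ⟨w, hw⟩ := exists_pow_eq_sum_mul_pow x (-((k.succ : ℕ) : ZMod p)⁻¹).val
    have hG : ∃ e : 𝓞 K, κ * ∑ y, ψ (c * (k.succ : ℕ) * y ^ 2) = e := by
      have h := AddChar.sum_mul_sq_pow_two hpr hψ (mul_ne_zero hc (hne k))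
      rw [← hγ2] at h
      rcases sq_eq_sq_iff_eq_or_eq_neg.1 h with h | h
      · exact ⟨1, by rw [h, hκ]; simp⟩
      · exact ⟨-1, by rw [h, mul_neg, hκ]; simp⟩
    obtain ⟨e, he⟩ := hG
    refine ⟨fun i ↦ e * w i, fun j ↦ ?_⟩
    have hw' := congrArg (algebraMap (𝓞 K) K) (hw j)
    rw [hSV, AddChar.sum_linear_add_quadratic ψ c _ (hne k), mul_left_comm, he, ← mul_neg, hψpow,
      ← hx, ← map_pow, hw', map_sum, Finset.sum_mul]
    refine Finset.sum_congr rfl fun i _ ↦ ?_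
    simp only [hVx, map_mul, map_pow]
    ring

/-- The matrix `V⁻¹ * S * V` is fixed by the automorphisms `ζ ↦ ζ ^ (s ^ 2)`. -/
theorem IsPrimitiveRoot.map_inv_mul_mul_eq [CharZero K] (hpr : p = 2 * r + 1) {ζ : K}
    (hζ : IsPrimitiveRoot ζ p) {c : ZMod p} {ε : ℤ} {γ : K}
    (hγ : γ = ∑ x, AddChar.zmodChar p hζ.pow_eq_one (c * x ^ 2))
    {S V : Matrix (Fin (r + 1)) (Fin (r + 1)) K} (hS0 : ∀ j, S j 0 = ε * γ / p)
    (hS : ∀ j (i : Fin r), S j i.succ = ε * γ / p *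
      (AddChar.zmodChar p hζ.pow_eq_one (2 * c * (j : ℕ) * (i.succ : ℕ)) +
        AddChar.zmodChar p hζ.pow_eq_one (-(2 * c * (j : ℕ) * (i.succ : ℕ)))))
    (hV : ∀ j k, V j k =
      AddChar.zmodChar p hζ.pow_eq_one (c * ((j : ℕ) : ZMod p) ^ 2 * (k : ℕ)))
    (hu : IsUnit V) {s : ZMod p} (hs : s ≠ 0) (σ : K →+* K)
    (hσ : ∀ a, σ (AddChar.zmodChar p hζ.pow_eq_one a) =
      AddChar.zmodChar p hζ.pow_eq_one (s ^ 2 * a)) :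
    (V⁻¹ * S * V).map σ = V⁻¹ * S * V := by
  set ψ := AddChar.zmodChar p hζ.pow_eq_one
  obtain ⟨π, hπ⟩ := ZMod.exists_perm_sq_eq hpr hs
  have hπ0 : π 0 = 0 := ZMod.fin_eq_of_sq_eq hpr (by rw [hπ]; simp)
  have hσγ : σ γ = γ := by
    rw [hγ, map_sum]
    conv_rhs => rw [← Equiv.sum_comp (Equiv.mulLeft₀ s hs)]
    refine Finset.sum_congr rfl fun x _ ↦ ?_
    rw [hσ, Equiv.mulLeft₀_apply]
    congr 1
    ring
  have hσκ : σ (ε * γ / p) = ε * γ / p := by simp [hσγ]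
  refine Matrix.map_inv_mul_mul_eq_of_submatrix σ π ?_ ?_ hu
  · ext j k
    rw [Matrix.map_apply, Matrix.submatrix_apply]
    rcases Fin.eq_zero_or_eq_succ k with rfl | ⟨k, rfl⟩
    · rw [hπ0, hS0, hS0, hσκ]
    · have hk : π k.succ ≠ 0 := fun h ↦ Fin.succ_ne_zero k (π.injective (h.trans hπ0.symm))
      obtain ⟨l, hl⟩ := Fin.exists_succ_eq.2 hk
      have hπk := hπ k.succ
      rw [← hl] at hπk ⊢
      rw [hS, hS, map_mul, hσκ, map_add, hσ, hσ]
      congr 1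
      have key : ∀ a b a' b' : ZMod p, a' ^ 2 = (s * a) ^ 2 → b' ^ 2 = (s * b) ^ 2 →
          ψ (s ^ 2 * (2 * c * a * b)) + ψ (s ^ 2 * -(2 * c * a * b)) =
            ψ (2 * c * a' * b') + ψ (-(2 * c * a' * b')) := by
        intro a b a' b' ha hb
        rcases sq_eq_sq_iff_eq_or_eq_neg.1 ha with rfl | rfl <;>
          rcases sq_eq_sq_iff_eq_or_eq_neg.1 hb with rfl | rfl
        · ring_nf
        · rw [add_comm]; ring_nf
        · rw [add_comm]; ring_nf
        · ring_nf
      exact key _ _ _ _ (hπ j) hπk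
  · ext j k
    rw [Matrix.map_apply, Matrix.submatrix_apply, hV, hV, hσ, hπ, id]
    congr 1
    ring

end Conjugation


/-- (Theorem `thm3` of the paper.)  The conjugated matrix
`S' = V⁻¹·S·V` has all its entries in the quadratic ring `ℤ[(1+g)/2]`, the ring of
integers of `ℚ(√(εp))`. -/
theorem conjugated_S_matrix_entries_in_quadratic_ring
    (p : ℕ+) [hp : Fact (p : ℕ).Prime] (hp2 : (p : ℕ) ≠ 2)
    (r : ℕ) (hr : r = ((p : ℕ) - 1) / 2)
    (ε : ℤ) (hε : ε = (-1) ^ r)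
    (ζ : CyclotomicField p ℚ) (hζ : IsPrimitiveRoot ζ (p : ℕ))
    (c : ℤ) (hc : ¬ ((p : ℕ) : ℤ) ∣ c)
    (γ : CyclotomicField p ℚ)
    (hγ : γ = ∑ x : ZMod (p : ℕ), ζ ^ (c * ((x.val : ℤ)) ^ 2))
    (g : CyclotomicField p ℚ)
    (hg : g = ∑ x : ZMod (p : ℕ), ζ ^ ((x.val : ℤ) ^ 2))
    (S V : Matrix (Fin (r + 1)) (Fin (r + 1)) (CyclotomicField p ℚ))
    (hS0 : ∀ j, S j 0 = (ε : CyclotomicField p ℚ) * γ / ((p : ℕ) : CyclotomicField p ℚ))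
    (hS1 : ∀ k, k ≠ 0 →
      S 0 k = 2 * ((ε : CyclotomicField p ℚ) * γ / ((p : ℕ) : CyclotomicField p ℚ)))
    (hS2 : ∀ j k, j ≠ 0 → k ≠ 0 →
      S j k = (ε : CyclotomicField p ℚ) * γ / ((p : ℕ) : CyclotomicField p ℚ) *
        (ζ ^ (2 * c * ((j : ℕ) : ℤ) * ((k : ℕ) : ℤ)) +
          ζ ^ (-(2 * c * ((j : ℕ) : ℤ) * ((k : ℕ) : ℤ)))))
    (hV : ∀ j k : Fin (r + 1), V j k = ζ ^ (c * ((j : ℕ) : ℤ) ^ 2 * ((k : ℕ) : ℤ))) :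
    IsUnit V ∧
      ∀ j k : Fin (r + 1), ∃ a b : ℤ,
        (V⁻¹ * S * V) j k = (a : CyclotomicField p ℚ) +
          (b : CyclotomicField p ℚ) * ((1 + g) / 2) := by
  have hpp : (p : ℕ).Prime := hp.out
  have hpr : (p : ℕ) = 2 * r + 1 := by
    have := hpp.eq_two_or_odd
    omega
  have hne : NeZero (((p : ℕ)) : ℚ) := ⟨Nat.cast_ne_zero.2 hpp.ne_zero⟩
  have hcyc : IsCyclotomicExtension {(p : ℕ)} ℚ (CyclotomicField p ℚ) :=
    CyclotomicField.isCyclotomicExtension p ℚ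
  have hnf : NumberField (CyclotomicField p ℚ) :=
    IsCyclotomicExtension.numberField {(p : ℕ)} ℚ _
  set ψ := AddChar.zmodChar (p : ℕ) hζ.pow_eq_one with hψdef
  have hψ : ψ.IsPrimitive := AddChar.zmodChar_primitive_of_primitive_root (p : ℕ) hζ
  have hz : ∀ m : ℤ, ζ ^ m = ψ m := fun m ↦ (AddChar.zmodChar_intCast _ m).symm
  have hc' : (c : ZMod p) ≠ 0 := by rwa [Ne, ZMod.intCast_zmod_eq_zero_iff_dvd]
  have hγ' : γ = ∑ x, ψ (c * x ^ 2) := by simp [hγ, hz]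
  have hg' : g = ∑ x, ψ (x ^ 2) := by simp [hg, hz]
  have hγ2 : γ ^ 2 = (-1) ^ r * ((p : ℕ) : CyclotomicField p ℚ) :=
    hγ' ▸ AddChar.sum_mul_sq_pow_two hpr hψ hc'
  have hp0 : ((p : ℕ) : CyclotomicField p ℚ) ≠ 0 := Nat.cast_ne_zero.2 hpp.ne_zero
  have hκ : (ε : CyclotomicField p ℚ) * γ / ((p : ℕ) : CyclotomicField p ℚ) * γ = 1 := by
    have h1 : (-1 : CyclotomicField p ℚ) ^ r * (-1) ^ r = 1 := by rw [← mul_pow]; simp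
    rw [div_mul_eq_mul_div, div_eq_one_iff_eq hp0, mul_assoc, ← sq, hγ2, hε, ← mul_assoc]
    push_cast
    rw [h1, one_mul]
  have hS : ∀ j (i : Fin r), S j i.succ =
      (ε : CyclotomicField p ℚ) * γ / ((p : ℕ) : CyclotomicField p ℚ) *
        (ψ (2 * c * (j : ℕ) * (i.succ : ℕ)) + ψ (-(2 * c * (j : ℕ) * (i.succ : ℕ)))) := by
    intro j i
    by_cases hj : j = 0
    · rw [hj, hS1 _ (Fin.succ_ne_zero i)]
      simp [AddChar.map_zero_eq_one]
      ring
    · rw [hS2 _ _ hj (Fin.succ_ne_zero i), hz, hz]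
      push_cast
      rfl
  have hV' : ∀ j k, V j k = ψ (c * ((j : ℕ) : ZMod p) ^ 2 * (k : ℕ)) := by
    intro j k
    rw [hV, hz]
    push_cast
    rfl
  have hu : IsUnit V := by
    have hvan : V = Matrix.vandermonde fun j ↦ ψ (c * ((j : ℕ) : ZMod p) ^ 2) := by
      ext j k
      rw [hV', Matrix.vandermonde_apply, mul_comm _ ((k : ℕ) : ZMod p), ← nsmul_eq_mul,
        AddChar.map_nsmul_eq_pow]
    rw [Matrix.isUnit_iff_isUnit_det, isUnit_iff_ne_zero, hvan, Matrix.det_vandermonde_ne_zero_iff]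
    intro j k hjk
    refine ZMod.fin_eq_of_sq_eq hpr (mul_left_cancel₀ hc' ?_)
    rw [← sub_eq_zero, ← hψ.zmod_char_eq_one_iff, AddChar.map_sub_eq_div]
    simp only at hjk
    rw [hjk, div_self (ψ.val_isUnit _).ne_zero]
  refine ⟨hu, fun j k ↦ ?_⟩
  rw [hg']
  refine hζ.exists_eq_add_mul_of_isIntegral_of_fixed hp2 ?_ fun s hs σ hσ ↦ ?_
  · obtain ⟨w, hw⟩ := hζ.exists_mul_vandermonde_apply_eq_sum hpr hc' hγ' hκ hS0 hS hV' k
    have : (V⁻¹ * S * V) j k = w j := by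
      have h1 : (S * V).col k = V.mulVec fun i ↦ (w i : CyclotomicField p ℚ) := funext hw
      have h2 : (V⁻¹ * S * V) j k = V⁻¹.mulVec ((S * V).col k) j := by
        rw [Matrix.mul_assoc]
        rfl
      rw [h2, h1, Matrix.mulVec_mulVec,
        Matrix.nonsing_inv_mul _ ((Matrix.isUnit_iff_isUnit_det V).1 hu), Matrix.one_mulVec]
    rw [this]
    exact (w j).isIntegral_coe
  · exact congrFun (congrFun (hζ.map_inv_mul_mul_eq hpr hγ' hS0 hS hV' hu hs
      (σ : CyclotomicField p ℚ →+* CyclotomicField p ℚ) hσ) j) k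
end

section
/- Let p be an odd prime, r = (p−1)/2, K = CyclotomicField p ℚ, ζ ∈ K a primitive p-th root of unity, and g = Σ_{x ∈ ZMod p} ζ^{x²}. Let t be a generator of the cyclic group (ZMod p)ˣ and let τ be the unique ring automorphism of K with τ(ζ) = ζ^{t²}. If x ∈ Algebra.adjoin ℤ {ζ} (i.e., x ∈ ℤ[ζ]) and τ(x) = x, then there exist integers a, b such that x = a + b·(1+g)/2. -/
/-- The sum of all `p`-th roots of unity vanishes. -/
theorem IsPrimitiveRoot.sum_zmodChar_eq_zero {K : Type*} [Field K] {p : ℕ} [hp : Fact p.Prime]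
    {ζ : K} (hζ : IsPrimitiveRoot ζ p) : ∑ i, AddChar.zmodChar p hζ.pow_eq_one i = 0 := by
  rw [← hζ.geom_sum_eq_zero hp.out.one_lt]
  exact Finset.sum_bij (fun i _ => i.val) (fun i _ => Finset.mem_range.2 i.val_lt)
    (fun i _ j _ h => ZMod.val_injective p h)
    (fun k hk => ⟨k, Finset.mem_univ _, ZMod.val_cast_of_lt (Finset.mem_range.1 hk)⟩)
    (fun _ _ => rfl)

open Polynomial in
/-- The only linear relations over `ℤ` between the `p`-th roots of unity are the multiples of
the one saying that their sum vanishes. -/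
theorem IsPrimitiveRoot.eq_of_sum_zmod_eq_zero {K : Type*} [Field K] [CharZero K] {p : ℕ}
    [hp : Fact p.Prime] {ζ : K} (hζ : IsPrimitiveRoot ζ p) (c : ZMod p → ℤ)
    (hc : ∑ i, (c i : K) * AddChar.zmodChar p hζ.pow_eq_one i = 0) (i : ZMod p) :
    c i = c (-1) := by
  let P : ℤ[X] := ∑ j : ZMod p, C (c j - c (-1)) * X ^ j.val
  have hcoeff (j : ZMod p) : P.coeff j.val = c j - c (-1) := by
    simp only [P, finsetSum_coeff, coeff_C_mul_X_pow, (ZMod.val_injective p).eq_iff]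
    simp
  have hroot : aeval ζ P = 0 := by
    have hsum := hζ.sum_zmodChar_eq_zero
    simp only [AddChar.zmodChar_apply] at hc hsum
    simp [P, sub_mul, Finset.sum_sub_distrib, hc, ← Finset.mul_sum, hsum]
  have hdeg : P.degree < ((p - 1 : ℕ) : WithBot ℕ) := by
    refine (degree_lt_iff_coeff_zero _ _).2 fun m hm => ?_
    rcases lt_or_ge m p with hmp | hmp
    · have hm1 : (m : ZMod p) = -1 := by
        have : m + 1 = p := by omega
        rw [eq_neg_iff_add_eq_zero, ← Nat.cast_add_one, this, ZMod.natCast_self]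
      have h := hcoeff m
      rwa [ZMod.val_cast_of_lt hmp, hm1, sub_self] at h
    · refine (finsetSum_coeff _ _ _).trans (Finset.sum_eq_zero fun j _ => ?_)
      rw [coeff_C_mul_X_pow, if_neg]
      exact (j.val_lt.trans_le hmp).ne'
  have hP : P = 0 := by
    by_contra hne
    have h := minpoly.IsIntegrallyClosed.degree_le_of_ne_zero hne hroot
    rw [← cyclotomic_eq_minpoly hζ hp.out.pos, degree_cyclotomic, Nat.totient_prime hp.out] at h
    exact absurd hdeg h.not_gt
  have h := hcoeff i
  rw [hP, coeff_zero] at h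
  omega

open Polynomial in
/-- Every element of `ℤ[ζ]` is an integral combination of the nontrivial `p`-th roots of unity. -/
theorem IsPrimitiveRoot.exists_sum_zmod_of_mem_adjoin {K : Type*} [Field K] {p : ℕ}
    [hp : Fact p.Prime] {ζ : K} (hζ : IsPrimitiveRoot ζ p) {x : K}
    (hx : x ∈ Algebra.adjoin ℤ {ζ}) :
    ∃ c : ZMod p → ℤ, c 0 = 0 ∧ x = ∑ i, (c i : K) * AddChar.zmodChar p hζ.pow_eq_one i := by
  obtain ⟨c, rfl⟩ : ∃ c : ZMod p → ℤ,
      x = ∑ i, (c i : K) * AddChar.zmodChar p hζ.pow_eq_one i := by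
    rw [Algebra.adjoin_singleton_eq_range_aeval] at hx
    obtain ⟨P, rfl⟩ := hx
    induction P using Polynomial.induction_on' with
    | add P Q hP hQ =>
      obtain ⟨c, hc⟩ := hP
      obtain ⟨d, hd⟩ := hQ
      refine ⟨c + d, ?_⟩
      rw [map_add, hc, hd]
      simp [add_mul, Finset.sum_add_distrib]
    | monomial k a =>
      refine ⟨Pi.single (k : ZMod p) a, ?_⟩
      rw [Finset.sum_eq_single (k : ZMod p) (fun j _ hj => by simp [hj]) (by simp)]
      simp [aeval_monomial, AddChar.zmodChar_apply']
  exact ⟨fun i => c i - c 0, by simp, by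
    simp [sub_mul, Finset.sum_sub_distrib, ← Finset.mul_sum, hζ.sum_zmodChar_eq_zero]⟩

/-- The sum of `f` over squares, weighted by the number of square roots. -/
theorem ZMod.sum_comp_sq {p : ℕ} [Fact p.Prime] (hp2 : p ≠ 2) {K : Type*} [CommRing K]
    (f : ZMod p → K) :
    ∑ x : ZMod p, f (x ^ 2) = ∑ a, ((quadraticChar (ZMod p) a + 1 : ℤ) : K) * f a := by
  rw [← Finset.sum_fiberwise Finset.univ (fun x : ZMod p => x ^ 2)]
  refine Finset.sum_congr rfl fun a _ => ?_
  rw [← quadraticChar_card_sqrts (by rwa [ZMod.ringChar_zmod_n]) a,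
    Finset.sum_congr rfl (g := fun _ => f a) (by simp +contextual)]
  simp

/-- The quadratic character is `-1` on a generator of the unit group. -/
theorem quadraticChar_eq_neg_one_of_forall_mem_zpowers {F : Type*} [Field F] [Fintype F]
    [DecidableEq F] (hF : ringChar F ≠ 2) {t : Fˣ}
    (ht : ∀ u : Fˣ, u ∈ Subgroup.zpowers t) : quadraticChar F t = -1 := by
  refine (quadraticChar_dichotomy t.ne_zero).resolve_left fun h => ?_
  obtain ⟨a, ha⟩ := quadraticChar_exists_neg_one hF
  have ha0 : a ≠ 0 := by rintro rfl; simp at ha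
  obtain ⟨k, hk⟩ := mem_powers_iff_mem_zpowers.2 (ht (Units.mk0 a ha0))
  have hk' : (t : F) ^ k = a := by simpa using congrArg Units.val hk
  rw [← hk', map_pow, h, one_pow] at ha
  norm_num at ha

/-- A function on a finite field that is invariant under multiplication by the square of a
generator is, on units, an affine function of the quadratic character. -/
theorem two_mul_eq_of_mul_sq_generator_invariant {F : Type*} [Field F] [Fintype F]
    [DecidableEq F] (hF : ringChar F ≠ 2) {t : Fˣ} (ht : ∀ u : Fˣ, u ∈ Subgroup.zpowers t)
    {c : F → ℤ} (hc : ∀ a, c ((t : F) ^ 2 * a) = c a) {a : F} (ha : a ≠ 0) :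
    2 * c a = (c 1 + c t) + (c 1 - c t) * quadraticChar F a := by
  have hiter (m : ℕ) (b : F) : c ((t : F) ^ (2 * m) * b) = c b := by
    induction m with
    | zero => simp
    | succ m ih => rw [mul_add_one, pow_add, mul_comm (_ ^ _), mul_assoc, hc, ih]
  obtain ⟨k, hk⟩ := mem_powers_iff_mem_zpowers.2 (ht (Units.mk0 a ha))
  have hk' : (t : F) ^ k = a := by simpa using congrArg Units.val hk
  have hχ := quadraticChar_eq_neg_one_of_forall_mem_zpowers hF ht
  rw [← hk', map_pow, hχ]
  obtain ⟨m, rfl | rfl⟩ := Nat.even_or_odd' k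
  · have h := hiter m 1
    rw [mul_one] at h
    rw [h, pow_mul]
    norm_num
    ring
  · rw [pow_succ, hiter, pow_succ, pow_mul]
    norm_num
    ring


/-- An element of `ℤ[ζ]` fixed by an endomorphism `ζ ↦ ζ ^ t ^ 2`, for `t` a generator of
`(ZMod p)ˣ`, lies in `ℤ[(1 + g) / 2]`, where `g` is the quadratic Gauss sum. -/
theorem IsPrimitiveRoot.exists_eq_add_mul_gaussSum_of_fixed {K : Type*} [Field K] [CharZero K]
    {p : ℕ} [hp : Fact p.Prime] (hp2 : p ≠ 2) {ζ : K} (hζ : IsPrimitiveRoot ζ p) {g : K}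
    (hg : g = ∑ x : ZMod p, ζ ^ ((x.val : ℤ) ^ 2)) {t : (ZMod p)ˣ}
    (ht : ∀ u : (ZMod p)ˣ, u ∈ Subgroup.zpowers t) {n : ℕ}
    (hn : (n : ZMod p) = (t : ZMod p) ^ 2) (τ : K →+* K) (hτ : τ ζ = ζ ^ n)
    {x : K} (hx : x ∈ Algebra.adjoin ℤ {ζ}) (hfix : τ x = x) :
    ∃ a b : ℤ, x = (a : K) + (b : K) * ((1 + g) / 2) := by
  have hF : ringChar (ZMod p) ≠ 2 := by rwa [ZMod.ringChar_zmod_n]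
  obtain ⟨c, hc0, hxc⟩ := hζ.exists_sum_zmod_of_mem_adjoin hx
  set e := AddChar.zmodChar p hζ.pow_eq_one with he
  have hsum : ∑ i, e i = 0 := hζ.sum_zmodChar_eq_zero
  have hτe (i : ZMod p) : τ (e i) = e ((t : ZMod p) ^ 2 * i) := by
    have h : (t : ZMod p) ^ 2 * i = ((n * i.val : ℕ) : ZMod p) := by simp [hn]
    rw [h, he, AddChar.zmodChar_apply', AddChar.zmodChar_apply, map_pow, hτ, pow_mul]
  have hinv (a : ZMod p) : c ((t : ZMod p) ^ 2 * a) = c a := by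
    have h2 : x = ∑ i, (c ((t : ZMod p) ^ 2 * i) : K) *
        e ((t : ZMod p) ^ 2 * i) := by
      rw [hxc]
      exact (Equiv.sum_comp (t ^ 2).mulLeft fun i => (c i : K) * e i).symm
    have h3 : ∑ i, ((c ((t : ZMod p) ^ 2 * i) - c i : ℤ) : K) *
        e ((t : ZMod p) ^ 2 * i) = 0 := by
      have h4 : x = ∑ i, (c i : K) * e ((t : ZMod p) ^ 2 * i) := by
        rw [← hfix, hxc, map_sum]
        simp [hτe]
      simp only [Int.cast_sub, sub_mul, Finset.sum_sub_distrib]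
      rw [← h2, ← h4, sub_self]
    have h5 : ∑ i, ((c ((t : ZMod p) ^ 2 * i) - c i : ℤ) : K) *
        e i = 0 := by
      apply τ.injective
      rw [map_zero, ← h3, map_sum]
      simp [hτe]
    have h6 := hζ.eq_of_sum_zmod_eq_zero _ h5
    have h7 := h6 a
    rw [← h6 0, mul_zero, sub_self] at h7
    omega
  have hg' : g = ∑ a, (quadraticChar (ZMod p) a : K) * e a := by
    have h : g = ∑ x : ZMod p, e (x ^ 2) := by
      rw [hg]
      refine Finset.sum_congr rfl fun i _ => ?_
      have h : i ^ 2 = ((i.val ^ 2 : ℕ) : ZMod p) := by simp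
      rw [h, he, AddChar.zmodChar_apply']
      exact_mod_cast rfl
    rw [h, ZMod.sum_comp_sq hp2]
    simp [add_mul, Finset.sum_add_distrib, hsum]
  have h2x : 2 * x = -((c 1 + c t : ℤ) : K) + ((c 1 - c t : ℤ) : _) * g := by
    have hterm (a : ZMod p) : 2 * ((c a : K) * e a) =
        ((c 1 + c t : ℤ) : K) * (e a - if a = 0 then 1 else 0) +
        ((c 1 - c t : ℤ) : K) *
          ((quadraticChar (ZMod p) a : K) * e a) := by
      rcases eq_or_ne a 0 with rfl | ha
      · simp [hc0]
      · have h := congrArg (Int.cast : ℤ → K)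
          (two_mul_eq_of_mul_sq_generator_invariant hF ht hinv ha)
        push_cast at h ⊢
        rw [if_neg ha, ← mul_assoc, h]
        ring
    rw [hxc, hg', Finset.mul_sum, Finset.sum_congr rfl fun a _ => hterm a,
      Finset.sum_add_distrib, ← Finset.mul_sum, ← Finset.mul_sum, Finset.sum_sub_distrib, hsum]
    simp
  refine ⟨-c 1, c 1 - c t, ?_⟩
  push_cast at h2x ⊢
  linear_combination h2x / 2

/-- Fixed points of the index-2 subgroup of the Galois group inside
`ℤ[ζ]` lie in `ℤ[(1+g)/2]`: if `t` generates `(ZMod p)ˣ`, `τ` is the automorphism of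
the cyclotomic field with `τ(ζ) = ζ^{t²}`, and `x ∈ ℤ[ζ]` satisfies `τ(x) = x`, then
`x = a + b·(1+g)/2` for some integers `a, b`, where `g` is the quadratic Gauss sum. -/
theorem fixed_points_of_index_two_galois_subgroup
    (p : ℕ+) [hp : Fact (p : ℕ).Prime] (hp2 : (p : ℕ) ≠ 2)
    (r : ℕ) (hr : r = ((p : ℕ) - 1) / 2)
    (ζ : CyclotomicField p ℚ) (hζ : IsPrimitiveRoot ζ (p : ℕ))
    (g : CyclotomicField p ℚ)
    (hg : g = ∑ x : ZMod (p : ℕ), ζ ^ ((x.val : ℤ) ^ 2))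
    (t : (ZMod (p : ℕ))ˣ) (ht : ∀ u : (ZMod (p : ℕ))ˣ, u ∈ Subgroup.zpowers t)
    (n : ℕ) (hn : (n : ZMod (p : ℕ)) = (t : ZMod (p : ℕ)) ^ 2)
    (τ : CyclotomicField p ℚ ≃+* CyclotomicField p ℚ) (hτ : τ ζ = ζ ^ n)
    (x : CyclotomicField p ℚ) (hx : x ∈ Algebra.adjoin ℤ {ζ}) (hfix : τ x = x) :
    ∃ a b : ℤ, x = (a : CyclotomicField p ℚ) +
      (b : CyclotomicField p ℚ) * ((1 + g) / 2) := by
  exact hζ.exists_eq_add_mul_gaussSum_of_fixed hp2 hg ht hn τ.toRingHom hτ hx hfix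
end
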